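/- For every $r \in [2, 6]$ there exists $C_r > 0$ such that for every $\psi \in C^\infty(\Omega)$ periodic on the box $\Omega = [0, L]^3$, $\|\psi\|_{L^r(\Omega)} \leq C_r \|\psi\|_{L^2(\Omega)}^{(6-r)/(2r)} \prod_{i=1}^{3} \left( \|\partial_{x_i}\psi\|_{L^2(\Omega)} + \|\psi\|_{L^2(\Omega)} \right)^{(r-2)/(2r)}$. -/

import Mathlib

open MeasureTheory Real ENNReal

/-- Partial derivative in the `i`-th coordinate direction on `ℝ × ℝ × ℝ`. -/
noncomputable def pd (i : Fin 3) (φ : ℝ × ℝ × ℝ → ℝ) : ℝ × ℝ × ℝ → ℝ :=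
  fun x => fderiv ℝ φ x (![((1:ℝ), (0:ℝ), (0:ℝ)), (0, 1, 0), (0, 0, 1)] i)

/-- Cauchy–Schwarz for lower integrals, with square roots. -/
lemma cs_half {α : Type*} [MeasurableSpace α] (μ : Measure α) {f g : α → ℝ≥0∞}
    (hf : Measurable f) (hg : Measurable g) :
    ∫⁻ a, f a ^ (1/2:ℝ) * g a ^ (1/2:ℝ) ∂μ
      ≤ (∫⁻ a, f a ∂μ) ^ (1/2:ℝ) * (∫⁻ a, g a ∂μ) ^ (1/2:ℝ) :=
  ENNReal.lintegral_mul_norm_pow_le hf.aemeasurable hg.aemeasurable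
    (by norm_num) (by norm_num) (by norm_num)

/-- Loomis–Whitney inequality in three dimensions. -/
lemma loomis (ν : Measure ℝ) [SFinite ν] {f g h : ℝ × ℝ → ℝ≥0∞}
    (hf : Measurable f) (hg : Measurable g) (hh : Measurable h) :
    ∫⁻ p : ℝ × ℝ × ℝ, f (p.2.1, p.2.2) ^ (1/2:ℝ) * (g (p.1, p.2.2) ^ (1/2:ℝ)
        * h (p.1, p.2.1) ^ (1/2:ℝ)) ∂(ν.prod (ν.prod ν))
      ≤ (∫⁻ q, f q ∂(ν.prod ν)) ^ (1/2:ℝ) * ((∫⁻ q, g q ∂(ν.prod ν)) ^ (1/2:ℝ)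
        * (∫⁻ q, h q ∂(ν.prod ν)) ^ (1/2:ℝ)) := by
  have hG : Measurable fun z => ∫⁻ x, g (x, z) ∂ν := hg.lintegral_prod_left'
  have hH : Measurable fun y => ∫⁻ x, h (x, y) ∂ν := hh.lintegral_prod_left'
  rw [lintegral_prod_symm' _ (by fun_prop)]
  calc ∫⁻ q : ℝ × ℝ, ∫⁻ x, f (q.1, q.2) ^ (1/2:ℝ) * (g (x, q.2) ^ (1/2:ℝ)
        * h (x, q.1) ^ (1/2:ℝ)) ∂ν ∂(ν.prod ν)
      ≤ ∫⁻ q : ℝ × ℝ, f q ^ (1/2:ℝ) * ((∫⁻ x, h (x, q.1) ∂ν) * (∫⁻ x, g (x, q.2) ∂ν)) ^ (1/2:ℝ)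
          ∂(ν.prod ν) := by
        refine lintegral_mono fun q => ?_
        rw [lintegral_const_mul _ (by fun_prop)]
        refine mul_le_mul_right ?_ _
        refine (cs_half ν (f := fun x => g (x, q.2)) (g := fun x => h (x, q.1))
          (by fun_prop) (by fun_prop)).trans ?_
        rw [← ENNReal.mul_rpow_of_nonneg _ _ (by norm_num), mul_comm]
    _ ≤ _ := by
        refine (cs_half (ν.prod ν) hf (by fun_prop)).trans ?_
        rw [lintegral_prod_mul hH.aemeasurable hG.aemeasurable,
          lintegral_prod_symm' g hg, lintegral_prod_symm' h hh,
          mul_comm (∫⁻ x, ∫⁻ y, h (y, x) ∂ν ∂ν),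
          ENNReal.mul_rpow_of_nonneg _ _ (by norm_num : (0:ℝ) ≤ 1/2)]

/-- One-dimensional pointwise bound. -/
lemma one_dim {L : ℝ} (hL : 0 < L) {u u' : ℝ → ℝ} (hu : ∀ s, HasDerivAt u (u' s) s)
    (hc : Continuous u') {t : ℝ} (ht : t ∈ Set.Icc 0 L) :
    ‖u t‖ₑ ^ 4 ≤ (ENNReal.ofReal (1 / L) + 4) *
      ∫⁻ s in Set.Icc 0 L, ‖u s‖ₑ ^ 3 * (‖u' s‖ₑ + ‖u s‖ₑ) := by
  have huc : Continuous u := continuous_iff_continuousAt.2 fun s => (hu s).continuousAt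
  set J : ℝ≥0∞ := ∫⁻ s in Set.Icc 0 L, ‖u s‖ₑ ^ 3 * ‖u' s‖ₑ with hJ
  set Q : ℝ≥0∞ := ∫⁻ s in Set.Icc 0 L, ‖u s‖ₑ ^ 4 with hQ
  have key : ∀ s ∈ Set.Icc 0 L, ‖u t‖ₑ ^ 4 ≤ ‖u s‖ₑ ^ 4 + 4 * J := by
    intro s hs
    have hd : ∀ x, HasDerivAt (fun x => u x ^ 4) (4 * u x ^ 3 * u' x) x := by
      intro x
      have h4 := (hu x).fun_pow 4
      norm_num at h4
      exact h4
    have hI : ∫ y in s..t, 4 * u y ^ 3 * u' y = u t ^ 4 - u s ^ 4 :=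
      intervalIntegral.integral_eq_sub_of_hasDerivAt (fun x _ => hd x)
        (Continuous.intervalIntegrable (by fun_prop) _ _)
    have h1 : ‖∫ y in s..t, 4 * u y ^ 3 * u' y‖ₑ ≤ 4 * J := by
      rw [← ofReal_norm, intervalIntegral.norm_intervalIntegral_eq,
        ofReal_norm]
      refine (enorm_integral_le_lintegral_enorm _).trans ?_
      have hsub : Set.uIoc s t ⊆ Set.Icc 0 L :=
        Set.uIoc_subset_uIcc.trans (Set.uIcc_subset_Icc hs ht)
      refine (lintegral_mono_set hsub).trans ?_
      rw [hJ, ← lintegral_const_mul _ (by fun_prop)]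
      refine lintegral_mono fun y => ?_
      rw [enorm_mul, enorm_mul, enorm_pow, mul_assoc]
      refine mul_le_mul_left (le_of_eq ?_) _
      rw [← ofReal_norm]; norm_num
    calc ‖u t‖ₑ ^ 4 = ‖u s ^ 4 + (u t ^ 4 - u s ^ 4)‖ₑ := by rw [← enorm_pow]; congr 1; ring
      _ ≤ ‖u s ^ 4‖ₑ + ‖u t ^ 4 - u s ^ 4‖ₑ := enorm_add_le _ _
      _ ≤ _ := by rw [enorm_pow, ← hI]; gcongr
  have h2 : ENNReal.ofReal L * ‖u t‖ₑ ^ 4 ≤ Q + ENNReal.ofReal L * (4 * J) := by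
    have := setLIntegral_mono (μ := volume) (s := Set.Icc 0 L) (f := fun _ => ‖u t‖ₑ ^ 4)
      (g := fun s => ‖u s‖ₑ ^ 4 + 4 * J) (by fun_prop) key
    rw [lintegral_add_right _ measurable_const] at this
    simpa [mul_comm, hQ] using this
  have hLL : ENNReal.ofReal (1 / L) * ENNReal.ofReal L = 1 := by
    rw [← ENNReal.ofReal_mul (by positivity)]; simp [hL.ne']
  have h3 : ‖u t‖ₑ ^ 4 ≤ ENNReal.ofReal (1 / L) * Q + 4 * J := by
    calc ‖u t‖ₑ ^ 4 = ENNReal.ofReal (1 / L) * (ENNReal.ofReal L * ‖u t‖ₑ ^ 4) := by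
          rw [← mul_assoc, hLL, one_mul]
      _ ≤ ENNReal.ofReal (1 / L) * (Q + ENNReal.ofReal L * (4 * J)) := by gcongr
      _ = _ := by rw [mul_add, ← mul_assoc (ENNReal.ofReal (1/L)), hLL, one_mul]
  have h4 : ∫⁻ s in Set.Icc 0 L, ‖u s‖ₑ ^ 3 * (‖u' s‖ₑ + ‖u s‖ₑ) = J + Q := by
    rw [hJ, hQ, ← lintegral_add_left (by fun_prop)]
    refine lintegral_congr fun s => ?_
    ring
  rw [h4]
  refine h3.trans ?_
  rw [add_mul, mul_add, mul_add]
  calc _ ≤ ENNReal.ofReal (1 / L) * Q + 4 * J + (ENNReal.ofReal (1 / L) * J + 4 * Q) :=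
        le_self_add
    _ = _ := by ring

lemma pd_cont {ψ : ℝ × ℝ × ℝ → ℝ} (h : ContDiff ℝ (⊤ : ℕ∞) ψ) (i : Fin 3) :
    Continuous (pd i ψ) := by
  unfold pd
  exact (h.continuous_fderiv (by simp)).clm_apply continuous_const

lemma pd0 {ψ : ℝ × ℝ × ℝ → ℝ} (h : ContDiff ℝ (⊤ : ℕ∞) ψ) (y z s : ℝ) :
    HasDerivAt (fun s => ψ (s, y, z)) (pd 0 ψ (s, y, z)) s := by
  have h1 := (h.differentiable (by simp) (s, y, z)).hasFDerivAt
  exact h1.comp_hasDerivAt s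
    ((hasDerivAt_id s).prodMk ((hasDerivAt_const s y).prodMk (hasDerivAt_const s z)))

lemma pd1 {ψ : ℝ × ℝ × ℝ → ℝ} (h : ContDiff ℝ (⊤ : ℕ∞) ψ) (x z s : ℝ) :
    HasDerivAt (fun s => ψ (x, s, z)) (pd 1 ψ (x, s, z)) s := by
  have h1 := (h.differentiable (by simp) (x, s, z)).hasFDerivAt
  exact h1.comp_hasDerivAt s
    ((hasDerivAt_const s x).prodMk ((hasDerivAt_id s).prodMk (hasDerivAt_const s z)))

lemma pd2 {ψ : ℝ × ℝ × ℝ → ℝ} (h : ContDiff ℝ (⊤ : ℕ∞) ψ) (x y s : ℝ) :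
    HasDerivAt (fun s => ψ (x, y, s)) (pd 2 ψ (x, y, s)) s := by
  have h1 := (h.differentiable (by simp) (x, y, s)).hasFDerivAt
  exact h1.comp_hasDerivAt s
    ((hasDerivAt_const s x).prodMk ((hasDerivAt_const s y).prodMk (hasDerivAt_id s)))

lemma box_measure (L : ℝ) :
    (volume.restrict (Set.Icc ((0:ℝ), (0:ℝ), (0:ℝ)) (L, L, L)) : Measure (ℝ × ℝ × ℝ)) =
      (volume.restrict (Set.Icc 0 L)).prod
        ((volume.restrict (Set.Icc 0 L)).prod (volume.restrict (Set.Icc 0 L))) := by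
  rw [Measure.prod_restrict, Measure.prod_restrict, Set.Icc_prod_eq, Set.Icc_prod_eq]
  rfl

lemma eLp2 {α : Type*} [MeasurableSpace α] (μ : Measure α) (f : α → ℝ) :
    eLpNorm f 2 μ = (∫⁻ x, ‖f x‖ₑ ^ 2 ∂μ) ^ (1/2:ℝ) := by
  rw [eLpNorm_eq_lintegral_rpow_enorm_toReal (by simp) (by simp)]
  simp

/-- Cauchy–Schwarz and Minkowski. -/
lemma int_F {α : Type*} [MeasurableSpace α] (μ : Measure α) {f g : α → ℝ}
    (hf : Measurable f) (hg : Measurable g) :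
    ∫⁻ x, ‖f x‖ₑ ^ 3 * (‖g x‖ₑ + ‖f x‖ₑ) ∂μ ≤
      (∫⁻ x, ‖f x‖ₑ ^ 6 ∂μ) ^ (1/2:ℝ) * (eLpNorm g 2 μ + eLpNorm f 2 μ) := by
  have hcs : ∀ h : α → ℝ, Measurable h → ∫⁻ x, ‖f x‖ₑ ^ 3 * ‖h x‖ₑ ∂μ ≤
      (∫⁻ x, ‖f x‖ₑ ^ 6 ∂μ) ^ (1/2:ℝ) * eLpNorm h 2 μ := by
    intro h hh
    rw [eLp2]
    refine le_trans (le_of_eq ?_) (cs_half μ (by fun_prop) (by fun_prop))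
    refine lintegral_congr fun x => ?_
    rw [← ENNReal.rpow_natCast_mul, ← ENNReal.rpow_natCast_mul, ← ENNReal.rpow_natCast]
    norm_num
  simp_rw [mul_add]
  rw [lintegral_add_left (by fun_prop)]
  exact add_le_add (hcs g hg) (hcs f hf)

lemma half_prod (a b c k t : ℝ≥0∞) (ha : t ^ 4 ≤ k * a) (hb : t ^ 4 ≤ k * b)
    (hc : t ^ 4 ≤ k * c) :
    t ^ 6 ≤ k ^ (3/2:ℝ) * (a ^ (1/2:ℝ) * (b ^ (1/2:ℝ) * c ^ (1/2:ℝ))) := by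
  have h : ∀ d, t ^ 4 ≤ k * d → t ^ 2 ≤ k ^ (1/2:ℝ) * d ^ (1/2:ℝ) := by
    intro d hd
    have := ENNReal.rpow_le_rpow hd (by norm_num : (0:ℝ) ≤ 1/2)
    rw [ENNReal.mul_rpow_of_nonneg _ _ (by norm_num), ← ENNReal.rpow_natCast_mul] at this
    refine le_trans (le_of_eq ?_) this
    rw [← ENNReal.rpow_natCast]; norm_num
  have hk : k ^ (3/2:ℝ) = k ^ (1/2:ℝ) * k ^ (1/2:ℝ) * k ^ (1/2:ℝ) := by
    rw [← ENNReal.rpow_add_of_nonneg _ _ (by norm_num) (by norm_num),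
      ← ENNReal.rpow_add_of_nonneg _ _ (by norm_num) (by norm_num)]; norm_num
  calc t ^ 6 = t ^ 2 * t ^ 2 * t ^ 2 := by ring
    _ ≤ _ := mul_le_mul' (mul_le_mul' (h a ha) (h b hb)) (h c hc)
    _ = _ := by rw [hk]; ring

/-- The anisotropic L⁶ estimate. -/
lemma six {L : ℝ} (hL : 0 < L) {ψ : ℝ × ℝ × ℝ → ℝ} (h : ContDiff ℝ (⊤ : ℕ∞) ψ)
    (μ : Measure (ℝ × ℝ × ℝ))
    (hμ : μ = volume.restrict (Set.Icc ((0:ℝ), (0:ℝ), (0:ℝ)) (L, L, L))) :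
    (∫⁻ x, ‖ψ x‖ₑ ^ 6 ∂μ) ^ (1/4:ℝ) ≤ (ENNReal.ofReal (1 / L) + 4) ^ (3/2:ℝ) *
      ((eLpNorm (pd 0 ψ) 2 μ + eLpNorm ψ 2 μ) ^ (1/2:ℝ) *
      ((eLpNorm (pd 1 ψ) 2 μ + eLpNorm ψ 2 μ) ^ (1/2:ℝ) *
       (eLpNorm (pd 2 ψ) 2 μ + eLpNorm ψ 2 μ) ^ (1/2:ℝ))) := by
  set K : ℝ≥0∞ := ENNReal.ofReal (1 / L) + 4 with hK
  have hψ := h.continuous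
  have hp := pd_cont h
  have hp0 := hp 0
  have hp1 := hp 1
  have hp2 := hp 2
  set I : ℝ≥0∞ := ∫⁻ x, ‖ψ x‖ₑ ^ 6 ∂μ with hI
  have hItop : I ≠ ⊤ := by
    have hc : IsCompact (Set.Icc ((0:ℝ), (0:ℝ), (0:ℝ)) (L, L, L)) := isCompact_Icc
    have hint : IntegrableOn (fun x => ψ x ^ 6) (Set.Icc ((0:ℝ), (0:ℝ), (0:ℝ)) (L, L, L)) :=
      (by fun_prop : Continuous fun x => ψ x ^ 6).continuousOn.integrableOn_compact hc
    have := hint.2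
    rw [HasFiniteIntegral, ← hμ] at this
    simp_rw [enorm_pow] at this
    exact this.ne
  set ν : Measure ℝ := volume.restrict (Set.Icc 0 L) with hν
  have hμ' : μ = ν.prod (ν.prod ν) := by rw [hμ, box_measure]
  let F : Fin 3 → ℝ × ℝ × ℝ → ℝ≥0∞ := fun i x => ‖ψ x‖ₑ ^ 3 * (‖pd i ψ x‖ₑ + ‖ψ x‖ₑ)
  have hF : ∀ i, Measurable (F i) := fun i => by
    have := hp i
    have hm : Measurable fun x => ‖ψ x‖ₑ ^ 3 * (‖pd i ψ x‖ₑ + ‖ψ x‖ₑ) := by fun_prop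
    exact hm
  have hFint : ∀ i, ∫⁻ x, F i x ∂μ ≤ I ^ (1/2:ℝ) * (eLpNorm (pd i ψ) 2 μ + eLpNorm ψ 2 μ) :=
    fun i => int_F μ hψ.measurable (hp i).measurable
  let g0 : ℝ × ℝ → ℝ≥0∞ := fun q => ∫⁻ s, F 0 (s, q.1, q.2) ∂ν
  let g1 : ℝ × ℝ → ℝ≥0∞ := fun q => ∫⁻ s, F 1 (q.1, s, q.2) ∂ν
  let g2 : ℝ × ℝ → ℝ≥0∞ := fun q => ∫⁻ s, F 2 (q.1, q.2, s) ∂ν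
  have hF0 := hF 0
  have hF1 := hF 1
  have hF2 := hF 2
  have m0 : Measurable g0 :=
    Measurable.lintegral_prod_right' (f := fun p : (ℝ × ℝ) × ℝ => F 0 (p.2, p.1.1, p.1.2))
      (by fun_prop)
  have m1 : Measurable g1 :=
    Measurable.lintegral_prod_right' (f := fun p : (ℝ × ℝ) × ℝ => F 1 (p.1.1, p.2, p.1.2))
      (by fun_prop)
  have m2 : Measurable g2 :=
    Measurable.lintegral_prod_right' (f := fun p : (ℝ × ℝ) × ℝ => F 2 (p.1.1, p.1.2, p.2))
      (by fun_prop)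
  have i0 : ∫⁻ q, g0 q ∂(ν.prod ν) = ∫⁻ x, F 0 x ∂μ := by
    rw [hμ', lintegral_prod_symm' _ hF0]
  have i1 : ∫⁻ q, g1 q ∂(ν.prod ν) = ∫⁻ x, F 1 x ∂μ := by
    rw [hμ', lintegral_prod _ hF1.aemeasurable, lintegral_prod _ m1.aemeasurable]
    refine lintegral_congr fun x => ?_
    rw [lintegral_prod_symm' _ (by fun_prop)]
  have i2 : ∫⁻ q, g2 q ∂(ν.prod ν) = ∫⁻ x, F 2 x ∂μ := by
    rw [hμ', lintegral_prod _ hF2.aemeasurable, lintegral_prod _ m2.aemeasurable]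
    refine lintegral_congr fun x => ?_
    rw [lintegral_prod _ (by fun_prop)]
  have hpt : ∀ x ∈ Set.Icc ((0:ℝ), (0:ℝ), (0:ℝ)) (L, L, L), ‖ψ x‖ₑ ^ 6 ≤
      K ^ (3/2:ℝ) * (g0 (x.2.1, x.2.2) ^ (1/2:ℝ) * (g1 (x.1, x.2.2) ^ (1/2:ℝ) *
        g2 (x.1, x.2.1) ^ (1/2:ℝ))) := by
    rintro ⟨x, y, z⟩ ⟨⟨hx, hy, hz⟩, ⟨hx', hy', hz'⟩⟩
    refine half_prod _ _ _ _ _ ?_ ?_ ?_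
    · exact one_dim hL (pd0 h y z) (by fun_prop) ⟨hx, hx'⟩
    · exact one_dim hL (pd1 h x z) (by fun_prop) ⟨hy, hy'⟩
    · exact one_dim hL (pd2 h x y) (by fun_prop) ⟨hz, hz'⟩
  have main : I ≤ K ^ (3/2:ℝ) * ((∫⁻ x, F 0 x ∂μ) ^ (1/2:ℝ) * ((∫⁻ x, F 1 x ∂μ) ^ (1/2:ℝ) *
      (∫⁻ x, F 2 x ∂μ) ^ (1/2:ℝ))) := by
    have := loomis ν m0 m1 m2
    rw [i0, i1, i2] at this
    refine le_trans ?_ (mul_le_mul_right this _)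
    rw [← lintegral_const_mul _ (by fun_prop), ← hμ', hI, hμ]
    exact setLIntegral_mono' measurableSet_Icc hpt
  set B : Fin 3 → ℝ≥0∞ := fun i => eLpNorm (pd i ψ) 2 μ + eLpNorm ψ 2 μ with hB
  have hFh : ∀ i, (∫⁻ x, F i x ∂μ) ^ (1/2:ℝ) ≤ I ^ (1/4:ℝ) * B i ^ (1/2:ℝ) := by
    intro i
    have := ENNReal.rpow_le_rpow (hFint i) (by norm_num : (0:ℝ) ≤ 1/2)
    rw [ENNReal.mul_rpow_of_nonneg _ _ (by norm_num), ← ENNReal.rpow_mul] at this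
    norm_num at this ⊢
    exact this
  have main2 : I ≤ I ^ (3/4:ℝ) * (K ^ (3/2:ℝ) * (B 0 ^ (1/2:ℝ) * (B 1 ^ (1/2:ℝ) *
      B 2 ^ (1/2:ℝ)))) := by
    have hk : I ^ (3/4:ℝ) = I ^ (1/4:ℝ) * I ^ (1/4:ℝ) * I ^ (1/4:ℝ) := by
      rw [← ENNReal.rpow_add_of_nonneg _ _ (by norm_num) (by norm_num),
        ← ENNReal.rpow_add_of_nonneg _ _ (by norm_num) (by norm_num)]; norm_num
    refine main.trans ((mul_le_mul_right (mul_le_mul' (hFh 0)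
      (mul_le_mul' (hFh 1) (hFh 2))) _).trans (le_of_eq ?_))
    rw [hk]; ring
  by_cases hI0 : I = 0
  · rw [hI0, ENNReal.zero_rpow_of_pos (by norm_num)]; exact zero_le
  have hsplit : I = I ^ (3/4:ℝ) * I ^ (1/4:ℝ) := by
    rw [← ENNReal.rpow_add_of_nonneg _ _ (by norm_num) (by norm_num)]; norm_num
  have hne : I ^ (3/4:ℝ) ≠ 0 := by simp [hI0]; norm_num
  have hnt : I ^ (3/4:ℝ) ≠ ⊤ := ENNReal.rpow_ne_top_of_nonneg (by norm_num) hItop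
  exact (ENNReal.mul_le_mul_iff_right hne hnt).1 (hsplit.symm.le.trans main2)

theorem stmt16 (r : ℝ) (hr : r ∈ Set.Icc (2:ℝ) 6) (L : ℝ) (hL : 0 < L) :
    ∃ C : ℝ≥0∞, 0 < C ∧ C ≠ ⊤ ∧ ∀ ψ : ℝ × ℝ × ℝ → ℝ,
      ContDiff ℝ (⊤ : ℕ∞) ψ →
      (∀ x : ℝ × ℝ × ℝ, ψ (x.1 + L, x.2.1, x.2.2) = ψ x) →
      (∀ x : ℝ × ℝ × ℝ, ψ (x.1, x.2.1 + L, x.2.2) = ψ x) →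
      (∀ x : ℝ × ℝ × ℝ, ψ (x.1, x.2.1, x.2.2 + L) = ψ x) →
      eLpNorm ψ (ENNReal.ofReal r)
          (volume.restrict (Set.Icc ((0:ℝ), (0:ℝ), (0:ℝ)) (L, L, L))) ≤
        C * eLpNorm ψ 2 (volume.restrict (Set.Icc ((0:ℝ), (0:ℝ), (0:ℝ)) (L, L, L)))
              ^ ((6 - r) / (2 * r))
          * (eLpNorm (pd 0 ψ) 2 (volume.restrict (Set.Icc ((0:ℝ), (0:ℝ), (0:ℝ)) (L, L, L)))
              + eLpNorm ψ 2 (volume.restrict (Set.Icc ((0:ℝ), (0:ℝ), (0:ℝ)) (L, L, L))))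
              ^ ((r - 2) / (2 * r))
          * (eLpNorm (pd 1 ψ) 2 (volume.restrict (Set.Icc ((0:ℝ), (0:ℝ), (0:ℝ)) (L, L, L)))
              + eLpNorm ψ 2 (volume.restrict (Set.Icc ((0:ℝ), (0:ℝ), (0:ℝ)) (L, L, L))))
              ^ ((r - 2) / (2 * r))
          * (eLpNorm (pd 2 ψ) 2 (volume.restrict (Set.Icc ((0:ℝ), (0:ℝ), (0:ℝ)) (L, L, L)))
              + eLpNorm ψ 2 (volume.restrict (Set.Icc ((0:ℝ), (0:ℝ), (0:ℝ)) (L, L, L))))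
              ^ ((r - 2) / (2 * r)) := by

  obtain ⟨hr2, hr6⟩ := hr
  have hr0 : 0 < r := by linarith
  have he : 0 ≤ (r - 2) / (2 * r) := div_nonneg (by linarith) (by linarith)
  have hK0 : (ENNReal.ofReal (1 / L) + 4) ≠ 0 := by simp
  have hKt : (ENNReal.ofReal (1 / L) + 4) ≠ ⊤ := by simp
  refine ⟨((ENNReal.ofReal (1 / L) + 4) ^ (3/2:ℝ)) ^ ((r - 2) / r), ?_, ?_, ?_⟩
  · exact ENNReal.rpow_pos (ENNReal.rpow_pos (pos_iff_ne_zero.2 hK0) hKt)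
      (ENNReal.rpow_ne_top_of_nonneg (by norm_num) hKt)
  · exact ENNReal.rpow_ne_top_of_nonneg (div_nonneg (by linarith) (by linarith))
      (ENNReal.rpow_ne_top_of_nonneg (by norm_num) hKt)
  intro ψ hψ _ _ _
  have h6 := six hL hψ _ rfl
  set μ : Measure (ℝ × ℝ × ℝ) :=
    volume.restrict (Set.Icc ((0:ℝ), (0:ℝ), (0:ℝ)) (L, L, L)) with hμ
  have hc := hψ.continuous
  have hb : 0 ≤ (r - 2) / r := div_nonneg (by linarith) (by linarith)
  have hint : ∫⁻ x, ‖ψ x‖ₑ ^ r ∂μ ≤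
      (∫⁻ x, ‖ψ x‖ₑ ^ 2 ∂μ) ^ ((6 - r) / 4) * (∫⁻ x, ‖ψ x‖ₑ ^ 6 ∂μ) ^ ((r - 2) / 4) := by
    refine le_trans (le_of_eq ?_) (ENNReal.lintegral_mul_norm_pow_le (by fun_prop) (by fun_prop)
      (by linarith) (by linarith) (by ring))
    refine lintegral_congr fun x => ?_
    rw [← ENNReal.rpow_natCast_mul, ← ENNReal.rpow_natCast_mul,
      ← ENNReal.rpow_add_of_nonneg _ _ (by push_cast; linarith) (by push_cast; linarith)]
    congr 1; push_cast; ring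
  have hnorm : eLpNorm ψ (ENNReal.ofReal r) μ = (∫⁻ x, ‖ψ x‖ₑ ^ r ∂μ) ^ (1 / r) := by
    rw [eLpNorm_eq_lintegral_rpow_enorm_toReal (by simpa using hr0) (by simp),
      ENNReal.toReal_ofReal hr0.le]
  have hA : ((∫⁻ x, ‖ψ x‖ₑ ^ 2 ∂μ) ^ ((6 - r) / 4)) ^ (1 / r) =
      eLpNorm ψ 2 μ ^ ((6 - r) / (2 * r)) := by
    rw [eLp2, ← ENNReal.rpow_mul, ← ENNReal.rpow_mul]
    congr 1; field_simp; ring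
  have hS : ((∫⁻ x, ‖ψ x‖ₑ ^ 6 ∂μ) ^ ((r - 2) / 4)) ^ (1 / r) =
      ((∫⁻ x, ‖ψ x‖ₑ ^ 6 ∂μ) ^ (1/4:ℝ)) ^ ((r - 2) / r) := by
    rw [← ENNReal.rpow_mul, ← ENNReal.rpow_mul]
    congr 1; field_simp
  have hB : ∀ b : ℝ≥0∞, (b ^ (1/2:ℝ)) ^ ((r - 2) / r) = b ^ ((r - 2) / (2 * r)) := by
    intro b
    rw [← ENNReal.rpow_mul]
    congr 1; field_simp
  rw [hnorm]
  refine (ENNReal.rpow_le_rpow hint (by positivity)).trans ?_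
  rw [ENNReal.mul_rpow_of_nonneg _ _ (by positivity), hA, hS]
  refine (mul_le_mul_right (ENNReal.rpow_le_rpow h6 hb) _).trans (le_of_eq ?_)
  rw [ENNReal.mul_rpow_of_nonneg _ _ hb, ENNReal.mul_rpow_of_nonneg _ _ hb,
    ENNReal.mul_rpow_of_nonneg _ _ hb, hB, hB, hB]
  ring
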